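/- In the decision problem with Θ = A = {1/n : n ∈ ℕ, n ≥ 1}, the minimax equality fails: ⨅_{μ} ⨆_{θ ∈ Θ} r(θ,μ) = 1, where μ ranges over all probability measures on A, while ⨆_{π} ⨅_{μ} r(π,μ) = -1, where π ranges over all countably additive probability measures on Θ and μ over all probability measures on A. -/

import Mathlib

open MeasureTheory

/-- The parameter space (= action space) `Θ = A = {1/n : n ∈ ℕ, n ≥ 1}`. -/
def Param : Type := {x : ℝ // ∃ n : ℕ, 0 < n ∧ x = 1 / (n : ℝ)}

/-- The real number underlying an element of `Param`. -/
def Param.toR (p : Param) : ℝ := Subtype.val p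

/-- `Param` is a countable discrete measurable space: its σ-algebra is the powerset. -/
instance : MeasurableSpace Param := ⊤

/-- The loss: `ℓ(θ,a) = 1` if `θ < a`, `0` if `θ = a`, `-1` if `θ > a`. -/
noncomputable def loss (θ a : Param) : ℝ :=
  if θ.toR < a.toR then 1 else if θ.toR = a.toR then 0 else -1

open Filter Topology

instance : DiscreteMeasurableSpace Param := ⟨fun _ => trivial⟩

namespace Param

/-- The point `1 / (n + 1)` of the parameter space. -/
noncomputable def invSucc (n : ℕ) : Param :=
  ⟨1 / ((n + 1 : ℕ) : ℝ), n + 1, n.succ_pos, rfl⟩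

lemma toR_pos (p : Param) : 0 < p.toR := by
  obtain ⟨x, n, hn, rfl⟩ := p
  have : (0 : ℝ) < n := by exact_mod_cast hn
  exact one_div_pos.2 this

lemma eventually_invSucc_lt (p : Param) : ∀ᶠ n in atTop, (invSucc n).toR < p.toR := by
  have h : Tendsto (fun n => (invSucc n).toR) atTop (𝓝 0) := by
    simpa [invSucc, Param.toR] using tendsto_one_div_add_atTop_nhds_zero_nat (𝕜 := ℝ)
  exact h.eventually_lt_const p.toR_pos

end Param

open Param

lemma norm_loss_le_one (θ a : Param) : ‖loss θ a‖ ≤ 1 := by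
  unfold loss
  split_ifs <;> simp

lemma norm_integral_le_one_of_norm_le_one {μ : Measure Param} [IsProbabilityMeasure μ]
    {f : Param → ℝ} (hf : ∀ a, ‖f a‖ ≤ 1) : ‖∫ a, f a ∂μ‖ ≤ 1 := by
  simpa using norm_integral_le_of_norm_le_const (μ := μ) (ae_of_all _ hf)

lemma tendsto_integral_of_norm_le_one {μ : Measure Param} [IsProbabilityMeasure μ]
    {f : ℕ → Param → ℝ} {c : ℝ} (hf : ∀ n a, ‖f n a‖ ≤ 1)
    (hc : ∀ a, ∀ᶠ n in atTop, f n a = c) :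
    Tendsto (fun n => ∫ a, f n a ∂μ) atTop (𝓝 c) := by
  have h := tendsto_integral_of_dominated_convergence (μ := μ) (F := f) (f := fun _ => c)
    (fun _ => 1) (fun n => (Measurable.of_discrete (f := f n)).aestronglyMeasurable)
    (integrable_const 1) (fun n => ae_of_all _ (hf n))
    (ae_of_all _ fun a => tendsto_const_nhds.congr' ((hc a).mono fun _ h => h.symm))
  simpa using h

lemma tendsto_integral_loss_invSucc_left (μ : Measure Param) [IsProbabilityMeasure μ] :
    Tendsto (fun n => ∫ a, loss (invSucc n) a ∂μ) atTop (𝓝 1) :=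
  tendsto_integral_of_norm_le_one (fun _ _ => norm_loss_le_one _ _) fun a =>
    (eventually_invSucc_lt a).mono fun _ h => if_pos h

lemma tendsto_integral_loss_invSucc_right (π : Measure Param) [IsProbabilityMeasure π] :
    Tendsto (fun n => ∫ θ, loss θ (invSucc n) ∂π) atTop (𝓝 (-1)) :=
  tendsto_integral_of_norm_le_one (fun _ _ => norm_loss_le_one _ _) fun θ =>
    (eventually_invSucc_lt θ).mono fun _ h => by simp [loss, h.not_gt, h.ne']

instance : Nonempty Param := ⟨invSucc 0⟩

instance : Nonempty {μ : Measure Param // IsProbabilityMeasure μ} :=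
  ⟨⟨Measure.dirac (invSucc 0), inferInstance⟩⟩

lemma iSup_risk_eq_one (μ : Measure Param) [IsProbabilityMeasure μ] :
    ⨆ θ : Param, ∫ a, loss θ a ∂μ = 1 := by
  have hle (θ : Param) : ∫ a, loss θ a ∂μ ≤ 1 :=
    (abs_le.1 (norm_integral_le_one_of_norm_le_one (norm_loss_le_one θ))).2
  refine le_antisymm (ciSup_le hle) ?_
  exact le_of_tendsto' (tendsto_integral_loss_invSucc_left μ) fun n =>
    le_ciSup (f := fun θ => ∫ a, loss θ a ∂μ) ⟨1, Set.forall_mem_range.2 hle⟩ (invSucc n)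

lemma iInf_bayesRisk_eq_neg_one (π : Measure Param) [IsProbabilityMeasure π] :
    ⨅ μ : {μ : Measure Param // IsProbabilityMeasure μ},
      ∫ θ, ∫ a, loss θ a ∂μ.1 ∂π = -1 := by
  have hge (μ : {μ : Measure Param // IsProbabilityMeasure μ}) :
      -1 ≤ ∫ θ, ∫ a, loss θ a ∂μ.1 ∂π := by
    have := μ.2
    exact (abs_le.1 (norm_integral_le_one_of_norm_le_one fun θ =>
      norm_integral_le_one_of_norm_le_one (norm_loss_le_one θ))).1
  refine le_antisymm ?_ (le_ciInf hge)
  refine ge_of_tendsto' (tendsto_integral_loss_invSucc_right π) fun n => ?_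
  have h := ciInf_le ⟨-1, Set.forall_mem_range.2 hge⟩ ⟨Measure.dirac (invSucc n), inferInstance⟩
  simpa only [integral_dirac] using h

/-- The minimax equality fails: the minimax value (over randomized procedures `μ`) is `1`,
while the maximin value over countably additive priors is `-1`. -/
theorem stmt4 :
    (⨅ μ : {μ : Measure Param // IsProbabilityMeasure μ},
      ⨆ θ : Param, ∫ a, loss θ a ∂μ.1) = 1
    ∧ (⨆ π : {π : Measure Param // IsProbabilityMeasure π},
        ⨅ μ : {μ : Measure Param // IsProbabilityMeasure μ},
          ∫ θ, ∫ a, loss θ a ∂μ.1 ∂π.1) = -1 := by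
  constructor
  · have h (μ : {μ : Measure Param // IsProbabilityMeasure μ}) :
        ⨆ θ : Param, ∫ a, loss θ a ∂μ.1 = 1 :=
      have := μ.2
      iSup_risk_eq_one μ.1
    simp only [h, ciInf_const]
  · have h (π : {π : Measure Param // IsProbabilityMeasure π}) :
        ⨅ μ : {μ : Measure Param // IsProbabilityMeasure μ},
          ∫ θ, ∫ a, loss θ a ∂μ.1 ∂π.1 = -1 :=
      have := π.2
      iInf_bayesRisk_eq_neg_one π.1
    simp only [h, ciSup_const]
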